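/- Let an ordered graph (G,<) be a graph with a linear order on vertices, and call a circuit v₁,…,v_l balanced if the number of indices i with v_i < v_{i+1} (cyclically) equals the number with v_i > v_{i+1}. For all positive integers r and p: for every ordered graph (G,<) with no unbalanced circuit of length ≤ p, there exists an ordered graph (H,<) with no unbalanced circuit of length ≤ p such that every r-coloring of the edges of H yields a monochromatic ordered subgraph isomorphic to (G,<). -/

import Mathlib

open SimpleGraph

/-- An ordered graph (a graph on a linearly ordered vertex set) has no
unbalanced circuit of length at most `p`: for every circuit (injective cyclic
sequence of adjacent vertices) of length at most `p`, the number of ascending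
steps equals the number of descending steps. -/
def BalUpTo {V : Type} [LinearOrder V] (G : SimpleGraph V) (p : ℕ) : Prop :=
  ∀ (n : ℕ) (v : Fin (n + 1) → V), Function.Injective v →
    (∀ i : Fin (n + 1), G.Adj (v i) (v (i + 1))) → n + 1 ≤ p →
    (Finset.univ.filter fun i : Fin (n + 1) => v i < v (i + 1)).card =
      (Finset.univ.filter fun i : Fin (n + 1) => v (i + 1) < v i).card


namespace RB

inductive WK {W : Type} (E : W → W → Prop) : ℕ → ℤ → W → W → Prop
  | nil (a : W) : WK E 0 0 a a
  | up {n : ℕ} {z : ℤ} {a b c : W} : E a b → WK E n z b c → WK E (n + 1) (z + 1) a c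
  | down {n : ℕ} {z : ℤ} {a b c : W} : E b a → WK E n z b c → WK E (n + 1) (z - 1) a c

def Bal {W : Type} (E : W → W → Prop) (l : ℕ) : Prop :=
  ∀ (n : ℕ) (z : ℤ) (a : W), n ≤ l → WK E n z a a → z = 0

theorem WK.cast {W : Type} {E : W → W → Prop} {n n' : ℕ} {z z' : ℤ} {a b : W}
    (h : WK E n z a b) (hn : n = n') (hz : z = z') : WK E n' z' a b := by
  subst hn; subst hz; exact h

theorem WK.append {W : Type} {E : W → W → Prop} {n m : ℕ} {z y : ℤ} {a b c : W}
    (h : WK E n z a b) (h' : WK E m y b c) : WK E (n + m) (z + y) a c := by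
  induction h with
  | nil a => exact h'.cast (by omega) (by omega)
  | up e _ ih => exact (WK.up e (ih h')).cast (by omega) (by omega)
  | down e _ ih => exact (WK.down e (ih h')).cast (by omega) (by omega)

theorem WK.map {W W' : Type} {E : W → W → Prop} {E' : W' → W' → Prop} (f : W → W')
    (hf : ∀ a b, E a b → E' (f a) (f b)) {n : ℕ} {z : ℤ} {a b : W}
    (h : WK E n z a b) : WK E' n z (f a) (f b) := by
  induction h with
  | nil a => exact WK.nil _
  | up e _ ih => exact WK.up (hf _ _ e) ih
  | down e _ ih => exact WK.down (hf _ _ e) ih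

theorem WK.zero {W : Type} {E : W → W → Prop} {n : ℕ} {z : ℤ} {a b : W}
    (h : WK E n z a b) (hn : n = 0) : z = 0 ∧ a = b := by
  cases h with
  | nil => exact ⟨rfl, rfl⟩
  | up => omega
  | down => omega

/-! The amalgamation step. -/

section step

variable {W0 P ι : Type} (E : P → P → Prop) (π : P → W0) (i j : W0)

abbrev Alph : Type := {e : P × P // E e.1 e.2 ∧ π e.1 = i ∧ π e.2 = j}

abbrev NV (ι : Type) : Type :=
  W0 × Option (Combinatorics.Line (Alph E π i j) ι) × (ι → P)

open Classical in
noncomputable def emb (L : Combinatorics.Line (Alph E π i j) ι) (x : P) : NV E π i j ι :=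
  (π x, if π x = i ∨ π x = j then none else some L, fun c =>
    match L.idxFun c with
    | none => x
    | some e => if π x = i then e.1.1 else if π x = j then e.1.2 else x)

def NE (a b : NV E π i j ι) : Prop :=
  ∃ (L : Combinatorics.Line (Alph E π i j) ι) (x y : P), E x y ∧ a = emb E π i j L x ∧
    b = emb E π i j L y

def LK (n : ℕ) (z : ℤ) (a b : NV E π i j ι) : Prop :=
  ∃ (L : Combinatorics.Line (Alph E π i j) ι) (x y : P), WK E n z x y ∧
    a = emb E π i j L x ∧ b = emb E π i j L y

def Sp (a : NV E π i j ι) : Prop := a.1 = i ∨ a.1 = j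

variable {E π i j}

theorem emb_inj (L : Combinatorics.Line (Alph E π i j) ι) {x y : P}
    (h : emb E π i j L x = emb E π i j L y) : x = y := by
  obtain ⟨c, hc⟩ := L.proper
  have := congrFun (congrArg (fun a => a.2.2) h) c
  simpa [emb, hc] using this

theorem emb_fst (L : Combinatorics.Line (Alph E π i j) ι) (x : P) :
    (emb E π i j L x).1 = π x := rfl

theorem emb_eq {L L' : Combinatorics.Line (Alph E π i j) ι} {x y : P}
    (h : emb E π i j L x = emb E π i j L' y) (hs : ¬ Sp E π i j (emb E π i j L x)) :
    L = L' ∧ x = y := by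
  have h1 : π x = π y := congrArg (fun a => a.1) h
  have h2 := congrArg (fun a => a.2.1) h
  have hs' : ¬ (π x = i ∨ π x = j) := hs
  have hs'' : ¬ (π y = i ∨ π y = j) := h1 ▸ hs'
  have : L = L' := by simpa [emb, hs', hs''] using h2
  subst this
  exact ⟨rfl, emb_inj L h⟩

theorem emb_pair (hij : i ≠ j) {L L' : Combinatorics.Line (Alph E π i j) ι} {u u' w w' : P}
    (hu : π u = i) (hw : π w = j)
    (h : emb E π i j L u = emb E π i j L' u') (h' : emb E π i j L w = emb E π i j L' w') :
    (u = u' ∧ w = w') ∨ (E u w ∧ E u' w') := by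
  have hu' : π u' = i := by
    have h1 : π u = π u' := congrArg (fun a => a.1) h
    rw [← h1, hu]
  have hw' : π w' = j := by
    have h1 : π w = π w' := congrArg (fun a => a.1) h'
    rw [← h1, hw]
  have hji := hij.symm
  have key : ∀ c, (match L.idxFun c with
      | none => u
      | some e => e.1.1) = (match L'.idxFun c with
      | none => u'
      | some e => e.1.1) := by
    intro c
    have := congrFun (congrArg (fun a => a.2.2) h) c
    simpa [emb, hu, hu'] using this
  have key' : ∀ c, (match L.idxFun c with
      | none => w
      | some e => e.1.2) = (match L'.idxFun c with
      | none => w'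
      | some e => e.1.2) := by
    intro c
    have := congrFun (congrArg (fun a => a.2.2) h') c
    simpa [emb, hw, hw', hji] using this
  obtain ⟨c, hc⟩ := L.proper
  obtain ⟨d, hd⟩ := L'.proper
  have kc := key c
  have kc' := key' c
  have kd := key d
  have kd' := key' d
  rw [hc] at kc kc'
  rw [hd] at kd kd'
  cases h1 : L'.idxFun c with
  | none =>
    rw [h1] at kc kc'
    exact Or.inl ⟨kc, kc'⟩
  | some e =>
    cases h2 : L.idxFun d with
    | none =>
      rw [h2] at kd kd'
      exact Or.inl ⟨kd, kd'⟩
    | some f =>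
      rw [h1] at kc kc'
      rw [h2] at kd kd'
      simp only at kc kc' kd kd'
      right
      rw [kc, kc', ← kd, ← kd']
      exact ⟨e.2.1, f.2.1⟩

theorem decomp {n : ℕ} {z : ℤ} {a b : NV E π i j ι} (h : WK (NE E π i j) n z a b) 
    (hb : Sp E π i j b) (hn : 0 < n) :
    ∃ n1 n2 z1 z2 s, 0 < n1 ∧ n1 + n2 = n ∧ z1 + z2 = z ∧ Sp E π i j s ∧
      LK E π i j n1 z1 a s ∧ WK (NE E π i j) n2 z2 s b := by
  induction h with
  | nil a => omega
  | @up n z a a' b e h ih =>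
    obtain ⟨L, x, y, hxy, rfl, rfl⟩ := e
    by_cases hs : Sp E π i j (emb E π i j L y)
    · exact ⟨1, n, 1, z, _, by omega, by omega, by omega, hs,
        ⟨L, x, y, (WK.up hxy (WK.nil y)).cast rfl (by omega), rfl, rfl⟩, h⟩
    · have hn' : 0 < n := by
        rcases Nat.eq_zero_or_pos n with h0 | h0
        · exact absurd ((h.zero h0).2 ▸ hb) hs
        · exact h0
      obtain ⟨n1, n2, z1, z2, s, h1, h2, h3, h4, ⟨L', x', y', hk, ha, rfl⟩, h6⟩ := ih hb hn'
      obtain ⟨rfl, rfl⟩ := emb_eq ha hs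
      exact ⟨n1 + 1, n2, z1 + 1, z2, _, by omega, by omega, by omega, h4,
        ⟨L, x, y', WK.up hxy hk, rfl, rfl⟩, h6⟩
  | @down n z a a' b e h ih =>
    obtain ⟨L, y, x, hxy, rfl, rfl⟩ := e
    by_cases hs : Sp E π i j (emb E π i j L y)
    · exact ⟨1, n, -1, z, _, by omega, by omega, by omega, hs,
        ⟨L, x, y, (WK.down hxy (WK.nil y)).cast rfl (by omega), rfl, rfl⟩, h⟩
    · have hn' : 0 < n := by
        rcases Nat.eq_zero_or_pos n with h0 | h0
        · exact absurd ((h.zero h0).2 ▸ hb) hs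
        · exact h0
      obtain ⟨n1, n2, z1, z2, s, h1, h2, h3, h4, ⟨L', x', y', hk, ha, rfl⟩, h6⟩ := ih hb hn'
      obtain ⟨rfl, rfl⟩ := emb_eq ha hs
      exact ⟨n1 + 1, n2, z1 - 1, z2, _, by omega, by omega, by omega, h4,
        ⟨L, x, y', WK.down hxy hk, rfl, rfl⟩, h6⟩

theorem decomp2 {n : ℕ} {z : ℤ} {a b : NV E π i j ι} (h : WK (NE E π i j) n z a b) :
    (n = 0) ∨ LK E π i j n z a b ∨
    ∃ n1 n2 z1 z2 s, n1 + n2 = n ∧ z1 + z2 = z ∧ Sp E π i j s ∧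
      WK (NE E π i j) n1 z1 a s ∧ WK (NE E π i j) n2 z2 s b := by
  induction h with
  | nil a => exact Or.inl rfl
  | @up n z a a' b e h ih =>
    right
    have e0 := e
    obtain ⟨L, x, y, hxy, rfl, rfl⟩ := e
    by_cases hs : Sp E π i j (emb E π i j L y)
    · right
      exact ⟨1, n, 1, z, _, by omega, by omega, hs,
        (WK.up e0 (WK.nil _)).cast rfl (by omega), h⟩
    · rcases ih with h0 | ⟨L', x', y', hk, ha, rfl⟩ | ⟨n1, n2, z1, z2, s, h2, h3, h4, h5, h6⟩
      · obtain ⟨hz, rfl⟩ := h.zero h0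
        subst h0; subst hz
        exact Or.inl ⟨L, x, y, WK.up hxy (WK.nil y), rfl, rfl⟩
      · obtain ⟨rfl, rfl⟩ := emb_eq ha hs
        exact Or.inl ⟨L, x, y', WK.up hxy hk, rfl, rfl⟩
      · exact Or.inr ⟨n1 + 1, n2, z1 + 1, z2, s, by omega, by omega, h4, WK.up e0 h5, h6⟩
  | @down n z a a' b e h ih =>
    right
    have e0 := e
    obtain ⟨L, y, x, hxy, rfl, rfl⟩ := e
    by_cases hs : Sp E π i j (emb E π i j L y)
    · right
      exact ⟨1, n, -1, z, _, by omega, by omega, hs,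
        (WK.down e0 (WK.nil _)).cast rfl (by omega), h⟩
    · rcases ih with h0 | ⟨L', x', y', hk, ha, rfl⟩ | ⟨n1, n2, z1, z2, s, h2, h3, h4, h5, h6⟩
      · obtain ⟨hz, rfl⟩ := h.zero h0
        subst h0; subst hz
        exact Or.inl ⟨L, x, y, WK.down hxy (WK.nil y), rfl, rfl⟩
      · obtain ⟨rfl, rfl⟩ := emb_eq ha hs
        exact Or.inl ⟨L, x, y', WK.down hxy hk, rfl, rfl⟩
      · exact Or.inr ⟨n1 + 1, n2, z1 - 1, z2, s, by omega, by omega, h4, WK.down e0 h5, h6⟩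

theorem NE_hom {E0 : W0 → W0 → Prop} (hπ : ∀ a b, E a b → E0 (π a) (π b))
    (a b : NV E π i j ι) (h : NE E π i j a b) : E0 a.1 b.1 := by
  obtain ⟨L, x, y, hxy, rfl, rfl⟩ := h
  exact hπ _ _ hxy

theorem LK.proj {E0 : W0 → W0 → Prop} (hπ : ∀ a b, E a b → E0 (π a) (π b)) {n : ℕ} {z : ℤ}
    {a b : NV E π i j ι} (h : LK E π i j n z a b) : WK E0 n z a.1 b.1 := by
  obtain ⟨L, x, y, hxy, rfl, rfl⟩ := h
  exact hxy.map π hπ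

theorem LK.closed {l : ℕ} (hB : Bal E l) {n : ℕ} {z : ℤ} (hn : n ≤ l)
    {a : NV E π i j ι} (h : LK E π i j n z a a) : z = 0 := by
  obtain ⟨L, x, y, hxy, rfl, h2⟩ := h
  have := emb_inj L h2
  subst this
  exact hB _ _ _ hn hxy

theorem two_seg (hij : i ≠ j) {l : ℕ} (hB : Bal E l) {n m : ℕ} {z y : ℤ}
    (hn : 0 < n) (hm : 0 < m) (hnm : n + m ≤ l) {a b : NV E π i j ι} (ha : a.1 = i)
    (hb : b.1 = j) (h : LK E π i j n z a b) (h' : LK E π i j m y b a) : z + y = 0 := by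
  obtain ⟨L, u, w, h, rfl, rfl⟩ := h
  obtain ⟨L', w', u', h', h1, h2⟩ := h'
  have ha' : π u = i := ha
  have hb' : π w = j := hb
  rcases emb_pair hij ha' hb' h2 h1 with ⟨rfl, rfl⟩ | ⟨e, e'⟩
  · exact hB _ _ _ hnm (h.append h')
  · have := hB _ _ _ (by omega) (h.append (WK.down e (WK.nil _)))
    have := hB _ _ _ (by omega) (h'.append (WK.up e' (WK.nil _)))
    omega

theorem NE_bal_sp (hij : i ≠ j) {E0 : W0 → W0 → Prop} (hπ : ∀ a b, E a b → E0 (π a) (π b))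
    {l : ℕ} (hB : Bal E (l + 1)) (hB0 : Bal E0 l) {n : ℕ} {z : ℤ} (hn : n ≤ l + 1)
    {a : NV E π i j ι} (ha : Sp E π i j a) (h : WK (NE E π i j) n z a a) : z = 0 := by
  have pr : ∀ {n z} {a b : NV E π i j ι}, WK (NE E π i j) n z a b → WK E0 n z a.1 b.1 :=
    fun h => h.map (fun a => a.1) (NE_hom hπ)
  rcases Nat.eq_zero_or_pos n with h0 | h0
  · exact (h.zero h0).1
  obtain ⟨n1, n2, z1, z2, s, h1, rfl, rfl, hs, k1, k2⟩ := decomp h ha h0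
  rcases Nat.eq_zero_or_pos n2 with h0' | h0'
  · obtain ⟨rfl, rfl⟩ := k2.zero h0'
    have := k1.closed hB (by omega)
    omega
  by_cases e1 : s.1 = a.1
  · have w1 := k1.proj hπ
    have w2 := pr k2
    rw [e1] at w1 w2
    have := hB0 _ _ _ (by omega) w1
    have := hB0 _ _ _ (by omega) w2
    omega
  obtain ⟨n3, n4, z3, z4, t, h3, rfl, rfl, ht, k3, k4⟩ := decomp k2 ha h0'
  rcases Nat.eq_zero_or_pos n4 with h0'' | h0''
  · obtain ⟨rfl, rfl⟩ := k4.zero h0''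
    rcases ha with ha | ha
    · have hs' : s.1 = j := by
        rcases hs with hs | hs
        · exact absurd (hs.trans ha.symm) e1
        · exact hs
      have := two_seg hij hB h1 h3 (by omega) ha hs' k1 k3
      omega
    · have hs' : s.1 = i := by
        rcases hs with hs | hs
        · exact hs
        · exact absurd (hs.trans ha.symm) e1
      have := two_seg hij hB h3 h1 (by omega) hs' ha k3 k1
      omega
  have w1 := k1.proj hπ
  have w3 := k3.proj hπ
  have w4 := pr k4
  have : t.1 = a.1 ∨ t.1 = s.1 := by
    rcases ha with ha | ha <;> rcases hs with hs | hs <;> rcases ht with ht | ht <;>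
      simp_all
  rcases this with e | e
  · rw [e] at w3 w4
    have := hB0 _ _ _ (by omega) (w1.append w3)
    have := hB0 _ _ _ (by omega) w4
    omega
  · rw [e] at w3 w4
    have := hB0 _ _ _ (by omega) (w1.append w4)
    have := hB0 _ _ _ (by omega) w3
    omega

theorem NE_bal (hij : i ≠ j) {E0 : W0 → W0 → Prop} (hπ : ∀ a b, E a b → E0 (π a) (π b))
    {l : ℕ} (hB : Bal E (l + 1)) (hB0 : Bal E0 l) : Bal (NE (ι := ι) E π i j) (l + 1) := by
  intro n z a hn h
  rcases decomp2 h with h0 | h0 | ⟨n1, n2, z1, z2, s, rfl, rfl, hs, k1, k2⟩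
  · exact (h.zero h0).1
  · exact h0.closed hB hn
  · have := NE_bal_sp hij hπ hB hB0 (by omega) hs (k2.append k1)
    omega

end step

/-- One step of the partite construction. -/
theorem step_pair {r : ℕ} {W0 P0 : Type} [Finite W0] {E0 : W0 → W0 → Prop}
    (hirr : ∀ a, ¬ E0 a a)
    (F : P0 → P0 → Prop) (π0 : P0 → W0) (hF : ∀ a b, F a b → E0 (π0 a) (π0 b))
    (l : ℕ) (hB0 : Bal E0 l) (S : Set (W0 × W0)) (i j : W0)
    (h : ∃ (P : Type) (_ : Finite P) (E : P → P → Prop) (π : P → W0),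
      (∀ a b, E a b → E0 (π a) (π b)) ∧ Bal E (l + 1) ∧
      ∀ c : P → P → Fin r, ∃ (f : P0 → P) (χ : W0 → W0 → Fin r), (∀ a, π (f a) = π0 a) ∧
        (∀ a b, F a b → E (f a) (f b)) ∧
        ∀ a b, F a b → (π0 a, π0 b) ∈ S → c (f a) (f b) = χ (π0 a) (π0 b)) :
    ∃ (P : Type) (_ : Finite P) (E : P → P → Prop) (π : P → W0),
      (∀ a b, E a b → E0 (π a) (π b)) ∧ Bal E (l + 1) ∧
      ∀ c : P → P → Fin r, ∃ (f : P0 → P) (χ : W0 → W0 → Fin r), (∀ a, π (f a) = π0 a) ∧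
        (∀ a b, F a b → E (f a) (f b)) ∧
        ∀ a b, F a b → (π0 a, π0 b) ∈ insert (i, j) S → 
          c (f a) (f b) = χ (π0 a) (π0 b) := by
  classical
  obtain ⟨P, hP, E, π, hπ, hB, hR⟩ := h
  by_cases hij : i = j
  · subst hij
    refine ⟨P, hP, E, π, hπ, hB, fun c => ?_⟩
    obtain ⟨f, χ, h1, h2, h3⟩ := hR c
    refine ⟨f, χ, h1, h2, fun a b hab hS => ?_⟩
    rcases hS with hS | hS
    · simp only [Prod.mk.injEq] at hS
      have := hF a b hab
      rw [hS.1, hS.2] at this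
      exact absurd this (hirr _)
    · exact h3 a b hab hS
  obtain ⟨ι, hι, hHJ⟩ := Combinatorics.Line.exists_mono_in_high_dimension
    (Alph E π i j) (Fin r)
  have hfin : Finite (Combinatorics.Line (Alph E π i j) ι) := by
    refine Finite.of_injective (fun L => L.idxFun) ?_
    intro L L' h
    cases L; cases L'; simp_all
  refine ⟨NV E π i j ι, inferInstance, NE E π i j, fun a => a.1, NE_hom hπ,
    NE_bal hij hπ hB hB0, fun c => ?_⟩
  obtain ⟨L, k, hk⟩ := hHJ (fun e => c
    (i, none, fun t => (e t).1.1) (j, none, fun t => (e t).1.2))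
  obtain ⟨f, χ, h1, h2, h3⟩ := hR (fun x y => c (emb E π i j L x) (emb E π i j L y))
  refine ⟨fun a => emb E π i j L (f a), fun a b => if (a, b) = (i, j) then k else χ a b,
    h1, fun a b hab => ⟨L, f a, f b, h2 a b hab, rfl, rfl⟩, fun a b hab hS => ?_⟩
  by_cases hc : (π0 a, π0 b) = (i, j)
  · simp only [hc, if_true]
    simp only [Prod.mk.injEq] at hc
    have ha : π (f a) = i := (h1 a).trans hc.1
    have hb : π (f b) = j := (h1 b).trans hc.2
    rw [← hk ⟨(f a, f b), h2 a b hab, ha, hb⟩]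
    congr 1
    · simp only [emb, ha, true_or, if_true]
      congr 2
      funext t
      cases ht : L.idxFun t <;> simp [Combinatorics.Line.coe_apply, ht]
    · simp only [emb, hb, or_true, if_true, if_neg (Ne.symm hij)]
      congr 2
      funext t
      cases ht : L.idxFun t <;> simp [Combinatorics.Line.coe_apply, ht]
  · simp only [hc, if_false]
    rcases hS with hS | hS
    · exact absurd hS hc
    · exact h3 a b hab hS

theorem all_pairs {r : ℕ} (hr : 0 < r) {W0 P0 : Type} [Finite W0] [Finite P0]
    {E0 : W0 → W0 → Prop} (hirr : ∀ a, ¬ E0 a a)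
    (F : P0 → P0 → Prop) (π0 : P0 → W0) (hF : ∀ a b, F a b → E0 (π0 a) (π0 b))
    (l : ℕ) (hB0 : Bal E0 l) (hBF : Bal F (l + 1)) :
    ∃ (P : Type) (_ : Finite P) (E : P → P → Prop) (π : P → W0),
      (∀ a b, E a b → E0 (π a) (π b)) ∧ Bal E (l + 1) ∧
      ∀ c : P → P → Fin r, ∃ (f : P0 → P) (χ : W0 → W0 → Fin r), (∀ a, π (f a) = π0 a) ∧
        (∀ a b, F a b → E (f a) (f b)) ∧
        ∀ a b, F a b → c (f a) (f b) = χ (π0 a) (π0 b) := by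
  have key : ∀ S : Set (W0 × W0), S.Finite → 
    ∃ (P : Type) (_ : Finite P) (E : P → P → Prop) (π : P → W0),
      (∀ a b, E a b → E0 (π a) (π b)) ∧ Bal E (l + 1) ∧
      ∀ c : P → P → Fin r, ∃ (f : P0 → P) (χ : W0 → W0 → Fin r), (∀ a, π (f a) = π0 a) ∧
        (∀ a b, F a b → E (f a) (f b)) ∧
        ∀ a b, F a b → (π0 a, π0 b) ∈ S → c (f a) (f b) = χ (π0 a) (π0 b) := by
    intro S hS
    induction S, hS using Set.Finite.induction_on with
    | empty => exact ⟨P0, inferInstance, F, π0, hF, hBF, fun c => ⟨id, fun _ _ => ⟨0, hr⟩,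
        fun _ => rfl, fun _ _ h => h, fun _ _ _ h => absurd h (Set.notMem_empty _)⟩⟩
    | insert _ _ ih => exact step_pair hirr F π0 hF l hB0 _ _ _ ih
  obtain ⟨P, hP, E, π, h1, h2, h3⟩ := key Set.univ Set.finite_univ
  refine ⟨P, hP, E, π, h1, h2, fun c => ?_⟩
  obtain ⟨f, χ, k1, k2, k3⟩ := h3 c
  exact ⟨f, χ, k1, k2, fun a b h => k3 a b h (Set.mem_univ _)⟩

/-- The statement for walks. -/
def Good (r : ℕ) {V : Type} [LinearOrder V] (A : V → V → Prop) (l : ℕ) : Prop :=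
  ∃ (W : Type) (_ : Finite W) (E : W → W → Prop) (ρ : W → ℕ),
    (∀ a b, E a b → ρ a < ρ b) ∧ Bal E l ∧
    ∀ c : W → W → Fin r, ∃ (g : V → W) (k : Fin r), StrictMono (fun v => ρ (g v)) ∧
      ∀ u v, A u v → E (g u) (g v) ∧ c (g u) (g v) = k

theorem good_succ {r : ℕ} (hr : 0 < r) {V : Type} [Finite V] [LinearOrder V]
    (A : V → V → Prop) (l : ℕ) (hA : Bal A (l + 1)) (h : Good r A l) : Good r A (l + 1) := by
  obtain ⟨W0, hW, E0, ρ, hρ, hB, hR⟩ := h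
  let C : Type := {g : V → W0 // StrictMono (fun v => ρ (g v)) ∧ ∀ u v, A u v → E0 (g u) (g v)}
  have hBF : Bal (fun a b : C × V => a.1 = b.1 ∧ A a.2 b.2) (l + 1) := fun n z a hn h =>
    hA n z a.2 hn (h.map (fun a => a.2) (fun _ _ h => h.2))
  obtain ⟨P, hP, E, π, h1, h2, h3⟩ := all_pairs hr
    (fun a h => lt_irrefl _ (hρ a a h)) (fun a b : C × V => a.1 = b.1 ∧ A a.2 b.2)
    (fun a => a.1.1 a.2) (fun a b h => by
      have h1 := a.1.2.2 _ _ h.2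
      obtain ⟨h0, _⟩ := h
      rw [← h0]; exact h1) l hB hBF
  refine ⟨P, hP, E, fun a => ρ (π a), fun a b h => hρ _ _ (h1 a b h), h2, fun c => ?_⟩
  obtain ⟨f, χ, k1, k2, k3⟩ := h3 c
  obtain ⟨g, k, m1, m2⟩ := hR χ
  let G : C := ⟨g, m1, fun u v h => (m2 u v h).1⟩
  refine ⟨fun v => f (G, v), k, ?_, fun u v h => ⟨k2 _ _ ⟨rfl, h⟩, ?_⟩⟩
  · simp only [k1]
    exact m1
  · rw [k3 (G, u) (G, v) ⟨rfl, h⟩]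
    exact (m2 u v h).2

/-! Ramsey's theorem. -/

theorem prehom (r : ℕ) (hr : 0 < r) (m : ℕ) : ∃ N, ∀ {α : Type} [LinearOrder α] (S : Finset α),
    N ≤ S.card → ∀ c : α → α → Fin r, ∃ (T : Finset α) (d : α → Fin r), T ⊆ S ∧ T.card = m ∧
      ∀ a ∈ T, ∀ b ∈ T, a < b → c a b = d a := by
  classical
  induction m with
  | zero => exact ⟨0, fun S _ c => ⟨∅, fun _ => ⟨0, hr⟩, by simp, by simp, by simp⟩⟩
  | succ m ih =>
    obtain ⟨N, hN⟩ := ih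
    refine ⟨r * N + 1, fun {α} _ S hS c => ?_⟩
    have hne : S.Nonempty := Finset.card_pos.1 (by omega)
    let a := S.min' hne
    have ha : a ∈ S := S.min'_mem hne
    obtain ⟨k, -, hk⟩ := Finset.exists_le_card_fiber_of_mul_le_card_of_maps_to
      (s := S.erase a) (t := (Finset.univ : Finset (Fin r))) (f := fun b => c a b) (n := N)
      (fun _ _ => Finset.mem_univ _) ⟨⟨0, hr⟩, Finset.mem_univ _⟩
      (by rw [Finset.card_erase_of_mem ha, Finset.card_univ, Fintype.card_fin]; omega)
    obtain ⟨T, d, hT, hc, hd⟩ := hN _ hk c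
    have hTS : ∀ b ∈ T, a < b ∧ b ∈ S ∧ c a b = k := by
      intro b hb
      have := hT hb
      simp only [Finset.mem_filter, Finset.mem_erase] at this
      exact ⟨lt_of_le_of_ne (S.min'_le b this.1.2) (Ne.symm this.1.1), this.1.2, this.2⟩
    have haT : a ∉ T := fun h => lt_irrefl _ (hTS a h).1
    refine ⟨insert a T, fun x => if x = a then k else d x, ?_, ?_, ?_⟩
    · intro x hx
      rcases Finset.mem_insert.1 hx with rfl | hx
      · exact ha
      · exact (hTS x hx).2.1
    · rw [Finset.card_insert_of_notMem haT, hc]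
    · intro x hx y hy hxy
      rcases Finset.mem_insert.1 hx with hx | hx <;> rcases Finset.mem_insert.1 hy with hy | hy
      · subst hx; subst hy; exact absurd hxy (lt_irrefl _)
      · simp only [if_pos hx]; rw [hx]; exact (hTS y hy).2.2
      · rw [hy] at hxy
        exact absurd (hxy.trans (hTS x hx).1) (lt_irrefl _)
      · have : x ≠ a := fun h => haT (h ▸ hx)
        simp only [if_neg this]
        exact hd x hx y hy hxy

theorem good_zero {r : ℕ} (hr : 0 < r) {V : Type} [Fintype V] [LinearOrder V]
    (A : V → V → Prop) (hA : ∀ u v, A u v → u < v) : Good r A 0 := by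
  classical
  obtain ⟨N, hN⟩ := prehom r hr (r * Fintype.card V)
  refine ⟨Fin N, inferInstance, fun a b => a < b, fun a => a, fun a b h => h,
    fun n z a hn h => (h.zero (by omega)).1, fun c => ?_⟩
  obtain ⟨T, d, -, hc, hd⟩ := hN (Finset.univ : Finset (Fin N)) (by simp) c
  obtain ⟨k, -, hk⟩ := Finset.exists_le_card_fiber_of_mul_le_card_of_maps_to
      (s := T) (t := (Finset.univ : Finset (Fin r))) (f := d) (n := Fintype.card V)
      (fun _ _ => Finset.mem_univ _) ⟨⟨0, hr⟩, Finset.mem_univ _⟩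
      (by rw [Finset.card_univ, Fintype.card_fin, hc])
  obtain ⟨U, hU, hUc⟩ := Finset.exists_subset_card_eq hk
  let o := U.orderEmbOfFin hUc
  let e := (Fintype.orderIsoFinOfCardEq V rfl).symm
  have hm : ∀ v, o (e v) ∈ T ∧ d (o (e v)) = k := fun v => by
    have := hU (U.orderEmbOfFin_mem hUc (e v))
    simpa using this
  have hs : ∀ u v, u < v → o (e u) < o (e v) := fun u v h => by simpa using h
  refine ⟨fun v => o (e v), k, fun u v h => hs u v h, fun u v h => ⟨hs _ _ (hA _ _ h), ?_⟩⟩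
  rw [hd _ (hm u).1 _ (hm v).1 (hs _ _ (hA _ _ h))]
  exact (hm u).2

theorem good_all {r : ℕ} (hr : 0 < r) {V : Type} [Fintype V] [LinearOrder V]
    (A : V → V → Prop) (hA : ∀ u v, A u v → u < v) (l : ℕ) (hB : Bal A l) : Good r A l := by
  induction l with
  | zero => exact good_zero hr A hA
  | succ l ih =>
    exact good_succ hr A l hB (ih (fun n z a hn h => hB n z a (by omega) h))

/-! Circuits and closed walks. -/

theorem WK_of_fun {W : Type} [LinearOrder W] {E : W → W → Prop} (u : ℕ → W) (i d : ℕ)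
    (h : ∀ k, i ≤ k → k < i + d → (u k < u (k + 1) ∧ E (u k) (u (k + 1))) ∨
      (¬ u k < u (k + 1) ∧ E (u (k + 1)) (u k))) :
    WK E d (∑ k ∈ Finset.Ico i (i + d), if u k < u (k + 1) then (1 : ℤ) else -1)
      (u i) (u (i + d)) := by
  induction d with
  | zero => simpa using WK.nil (u i)
  | succ d ih =>
    have h1 := ih (fun k hk hk' => h k hk (by omega))
    rw [← add_assoc, Finset.sum_Ico_succ_top (by omega)]
    rcases h (i + d) (by omega) (by omega) with ⟨h2, h3⟩ | ⟨h2, h3⟩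
    · rw [if_pos h2]
      exact h1.append ((WK.up h3 (WK.nil _)).cast rfl (by omega))
    · rw [if_neg h2]
      exact h1.append ((WK.down h3 (WK.nil _)).cast rfl (by omega))

theorem fun_of_WK {V : Type} [LinearOrder V] (G : SimpleGraph V) {n : ℕ} {z : ℤ} {a b : V}
    (h : WK (fun u v => G.Adj u v ∧ u < v) n z a b) :
    ∃ u : ℕ → V, u 0 = a ∧ u n = b ∧ (∀ k < n, G.Adj (u k) (u (k + 1))) ∧
      z = ∑ k ∈ Finset.range n, if u k < u (k + 1) then (1 : ℤ) else -1 := by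
  induction h with
  | nil a => exact ⟨fun _ => a, rfl, rfl, by simp, by simp⟩
  | @up n z a b c e h ih =>
    obtain ⟨u, h0, hn, hu, hz⟩ := ih
    refine ⟨fun k => Nat.casesOn k a u, rfl, hn, ?_, ?_⟩
    · intro k hk
      cases k with
      | zero => simpa [h0] using e.1
      | succ k => exact hu k (by omega)
    · rw [Finset.sum_range_succ', hz]
      simp [h0, e.2]
  | @down n z a b c e h ih =>
    obtain ⟨u, h0, hn, hu, hz⟩ := ih
    refine ⟨fun k => Nat.casesOn k a u, rfl, hn, ?_, ?_⟩
    · intro k hk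
      cases k with
      | zero => simpa [h0] using e.1.symm
      | succ k => exact hu k (by omega)
    · rw [Finset.sum_range_succ', hz]
      simp [h0, e.2.le, sub_eq_add_neg]

theorem sum_sign {V : Type} [LinearOrder V] {n : ℕ} (v w : Fin n → V) (h : ∀ i, v i ≠ w i) :
    (∑ i, if v i < w i then (1 : ℤ) else -1) =
      ((Finset.univ.filter fun i => v i < w i).card : ℤ) -
        (Finset.univ.filter fun i => w i < v i).card := by
  rw [Finset.card_filter, Finset.card_filter]
  push_cast
  rw [← Finset.sum_sub_distrib]
  refine Finset.sum_congr rfl fun i _ => ?_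
  rcases lt_or_gt_of_ne (h i) with h | h
  · simp [h, not_lt_of_gt h]
  · simp [h, not_lt_of_gt h]

theorem bal_of_balUpTo {V : Type} [LinearOrder V] (G : SimpleGraph V) (p : ℕ)
    (h : BalUpTo G p) : Bal (fun u v => G.Adj u v ∧ u < v) p := by
  intro n
  induction n using Nat.strong_induction_on with
  | _ n ih =>
  intro z a hn hw
  obtain ⟨u, h0, h1, hu, hz⟩ := fun_of_WK G hw
  have hstep : ∀ k, k < n → (u k < u (k + 1) ∧ (G.Adj (u k) (u (k + 1)) ∧ u k < u (k + 1))) ∨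
      (¬ u k < u (k + 1) ∧ (G.Adj (u (k + 1)) (u k) ∧ u (k + 1) < u k)) := by
    intro k hk
    have hk' := hu k hk
    rcases lt_or_gt_of_ne hk'.ne with h | h
    · exact Or.inl ⟨h, hk', h⟩
    · exact Or.inr ⟨not_lt_of_gt h, hk'.symm, h⟩
  have seg : ∀ i j, i ≤ j → j ≤ n → WK (fun u v => G.Adj u v ∧ u < v) (j - i)
      (∑ k ∈ Finset.Ico i j, if u k < u (k + 1) then (1 : ℤ) else -1) (u i) (u j) := by
    intro i j hij hj
    have := WK_of_fun (E := fun u v => G.Adj u v ∧ u < v) u i (j - i)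
      (fun k _ hk => hstep k (by omega))
    rwa [Nat.add_sub_cancel' hij] at this
  by_cases hrep : ∃ i j, i < j ∧ j < n ∧ u i = u j
  · obtain ⟨i, j, hij, hj, he⟩ := hrep
    have w1 := seg 0 i (by omega) (by omega)
    have w2 := seg i j (by omega) (by omega)
    have w3 := seg j n (by omega) (by omega)
    rw [← he] at w2 w3
    rw [h1, ← h0] at w3
    have z1 := ih _ (by omega) _ _ (by omega) w2
    have z2 := ih _ (by omega) _ _ (by omega) (w1.append w3)
    rw [hz, Finset.range_eq_Ico, ← Finset.sum_Ico_consecutive _ (Nat.zero_le i) (by omega : i ≤ n),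
      ← Finset.sum_Ico_consecutive _ hij.le hj.le, z1, zero_add]
    exact z2
  · push Not at hrep
    cases n with
    | zero => simpa using hz
    | succ m =>
      have hsucc : ∀ i : Fin (m + 1), u ((i + 1 : Fin (m + 1)) : ℕ) = u ((i : ℕ) + 1) := by
        intro i
        rw [Fin.val_add_one]
        split_ifs with hi
        · rw [hi, h0, Fin.val_last, h1]
        · rfl
      have hb := h m (fun i => u i) (by
        intro i j hij
        by_contra hne
        rcases lt_or_gt_of_ne hne with hl | hl
        · exact hrep i j hl j.2 hij
        · exact hrep j i hl i.2 hij.symm) (by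
        intro i
        simp only [hsucc]
        exact hu i i.2) hn
      rw [hz, Finset.sum_range]
      have := sum_sign (fun i : Fin (m + 1) => u i) (fun i : Fin (m + 1) => u (i + 1 : ℕ))
        (fun i => (hu i i.2).ne)
      rw [this]
      simp only [hsucc] at hb
      omega

theorem balUpTo_of_bal {V : Type} [LinearOrder V] (G : SimpleGraph V) (p : ℕ)
    (h : Bal (fun u v => G.Adj u v ∧ u < v) p) : BalUpTo G p := by
  intro n v _ hv hn
  have hw := WK_of_fun (E := fun u v => G.Adj u v ∧ u < v) (fun k : ℕ => v (Fin.ofNat (n + 1) k))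
    0 (n + 1) (by
      intro k _ _
      have hk : Fin.ofNat (n + 1) (k + 1) = Fin.ofNat (n + 1) k + 1 := by
        ext; simp [Fin.val_add]
      simp only [hk]
      have hk' := hv (Fin.ofNat (n + 1) k)
      rcases lt_or_gt_of_ne hk'.ne with h | h
      · exact Or.inl ⟨h, hk', h⟩
      · exact Or.inr ⟨not_lt_of_gt h, hk'.symm, h⟩)
  have he : Fin.ofNat (n + 1) (0 + (n + 1)) = Fin.ofNat (n + 1) 0 := by ext; simp
  rw [he] at hw
  have hz := h _ _ _ hn hw
  rw [zero_add, ← Finset.range_eq_Ico, Finset.sum_range] at hz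
  have hk : ∀ k : ℕ, Fin.ofNat (n + 1) (k + 1) = Fin.ofNat (n + 1) k + 1 := by
    intro k; ext; simp [Fin.val_add]
  have hk2 : ∀ i : Fin (n + 1), Fin.ofNat (n + 1) (i : ℕ) = i := by
    intro i; ext; simp [Nat.mod_eq_of_lt i.2]
  simp only [hk, hk2] at hz
  rw [sum_sign v (fun i => v (i + 1)) (fun i => (hv i).ne)] at hz
  omega

theorem exists_order {W : Type} [Finite W] (ρ : W → ℕ) :
    ∃ (m : ℕ) (e : W ≃ Fin m), ∀ a b, ρ a < ρ b → e a < e b := by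
  classical
  have := Fintype.ofFinite W
  let q := Fintype.equivFin W
  let f : W → ℕ ×ₗ Fin (Fintype.card W) := fun a => toLex (ρ a, q a)
  have hf : Function.Injective f := by
    intro a b h
    have : (ρ a, q a) = (ρ b, q b) := toLex.injective h
    exact q.injective (Prod.mk.inj this).2
  letI : LinearOrder W := LinearOrder.lift' f hf
  refine ⟨Fintype.card W, (Fintype.orderIsoFinOfCardEq W rfl).symm.toEquiv, fun a b h => ?_⟩
  have hab : a < b := by
    change f a < f b
    exact Prod.Lex.toLex_lt_toLex.2 (Or.inl h)
  exact (Fintype.orderIsoFinOfCardEq W rfl).symm.lt_iff_lt.2 hab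

end RB

/-- Ramsey theorem for ordered graphs with no short unbalanced
circuit: for all `r, p ≥ 1` and every finite ordered graph `G ∈ Bal_p` there
is an ordered graph `H ∈ Bal_p` such that every `r`-coloring of `E(H)` admits
a monochromatic order-preserving copy of `G`. -/
theorem ramsey_balanced (r p : ℕ) (hr : 0 < r) (hp : 0 < p)
    {V : Type} [Fintype V] [LinearOrder V] (G : SimpleGraph V)
    (hG : BalUpTo G p) :
    ∃ (m : ℕ) (H : SimpleGraph (Fin m)), BalUpTo H p ∧
      ∀ c : H.edgeSet → Fin r,
        ∃ (g : V → Fin m) (k : Fin r), StrictMono g ∧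
          (∀ u v : V, G.Adj u v → H.Adj (g u) (g v)) ∧
          ∀ e : H.edgeSet,
            (∃ u v : V, G.Adj u v ∧ (e : Sym2 (Fin m)) = s(g u, g v)) →
            c e = k := by
  classical
  obtain ⟨W, hW, E, ρ, hρ, hB, hR⟩ := RB.good_all hr (fun u v => G.Adj u v ∧ u < v)
    (fun u v h => h.2) p (RB.bal_of_balUpTo G p hG)
  obtain ⟨m, e, he⟩ := RB.exists_order ρ
  let H : SimpleGraph (Fin m) :=
    { Adj := fun x y => E (e.symm x) (e.symm y) ∨ E (e.symm y) (e.symm x)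
      symm := ⟨fun x y h => h.symm⟩
      loopless := ⟨fun x h => by
        rcases h with h | h <;> exact lt_irrefl _ (hρ _ _ h)⟩ }
  have hE : ∀ a b, E a b → H.Adj (e a) (e b) := fun a b h => by
    left; simpa using h
  refine ⟨m, H, RB.balUpTo_of_bal H p ?_, fun c => ?_⟩
  · intro n z a hn h
    refine hB n z (e.symm a) hn (h.map e.symm ?_)
    rintro x y ⟨h | h, hxy⟩
    · exact h
    · have := he _ _ (hρ _ _ h)
      simp only [Equiv.apply_symm_apply] at this
      exact absurd (hxy.trans this) (lt_irrefl _)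
  · obtain ⟨g, k, hg, hk⟩ := hR (fun a b => if h : H.Adj (e a) (e b) then
      c ⟨s(e a, e b), h⟩ else ⟨0, hr⟩)
    have hadj : ∀ u v : V, G.Adj u v → H.Adj (e (g u)) (e (g v)) := by
      intro u v h
      rcases lt_or_gt_of_ne h.ne with h' | h'
      · exact hE _ _ (hk u v ⟨h, h'⟩).1
      · exact (hE _ _ (hk v u ⟨h.symm, h'⟩).1).symm
    have hcol : ∀ u v : V, G.Adj u v → u < v → ∀ x : H.edgeSet,
        (x : Sym2 (Fin m)) = s(e (g u), e (g v)) → c x = k := by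
      intro u v h h' x hx
      have := (hk u v ⟨h, h'⟩).2
      rw [dif_pos (hadj u v h)] at this
      rw [← this]
      congr 1
      exact Subtype.ext hx
    refine ⟨fun v => e (g v), k, fun u v h => he _ _ (hg h), hadj, ?_⟩
    rintro x ⟨u, v, h, hx⟩
    rcases lt_or_gt_of_ne h.ne with h' | h'
    · exact hcol u v h h' x hx
    · exact hcol v u h.symm h' x (hx.trans Sym2.eq_swap)
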